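/- For every latent dimension d ≥ 1 and every noise level σ > 0 there exists a constant c > 0 such that for all integers n, T and all reals L ≥ 0 satisfying n − d + 1 ≥ 16, n ≥ 2d and T ≥ 4, the minimax risk for the Gaussian dynamic latent space model satisfies inf_{X̂} sup_{𝒳 ∈ PWD(L)} E_{Y ∼ P_𝒳}[ (1/(T n (n−1))) Σ_{t=1}^{T} Σ_{1 ≤ i ≠ j ≤ n} ( ⟨x̂_{it}, x̂_{jt}⟩ − ⟨x_{it}, x_{jt}⟩ )² ] ≥ c ( min{ L^{2/3} / (n^{4/3} T^{2/3}), 1/n } + 1/(nT) ), where the infimum ranges over all measurable estimators X̂ mapping the observation array to a configuration (x̂_{it}). -/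

import Mathlib

open MeasureTheory ProbabilityTheory
open scoped RealInnerProductSpace ENNReal

/-- A dynamic latent configuration: a latent position in `ℝ^d` for each node `i ∈ {1,…,n}`
and each time `t ∈ {1,…,T}`. -/
abbrev Config (n T d : ℕ) := Fin n → Fin T → EuclideanSpace ℝ (Fin d)

/-- The smoothness class `PWD(L)`:
`Σ_{t=2}^{T} Σ_{i=1}^{n} ‖x_{it} − x_{i(t−1)}‖₂ ≤ L`. -/
def PWD (n T d : ℕ) (L : ℝ) : Set (Config n T d) :=
  {X | ∑ t : Fin (T - 1), ∑ i : Fin n,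
      ‖X i ⟨t.1 + 1, by have := t.isLt; omega⟩ - X i ⟨t.1, by have := t.isLt; omega⟩‖ ≤ L}

/-- Index set of observations: ordered pairs `(i, j)` of distinct nodes together with
a time point `t`. -/
abbrev ObsIdx (n T : ℕ) := {p : Fin n × Fin n × Fin T // p.1 ≠ p.2.1}

/-- The Gaussian dynamic latent space model: given a configuration `X`, the observations
`Y_{ijt}` for `i ≠ j` are independent with `Y_{ijt} ∼ N(⟨x_{it}, x_{jt}⟩, σ²)`. -/
noncomputable def gaussianModel (n T d : ℕ) (σ : ℝ) (X : Config n T d) :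
    Measure (ObsIdx n T → ℝ) :=
  Measure.pi fun q => gaussianReal ⟪X q.1.1 q.1.2.2, X q.1.2.1 q.1.2.2⟫ (Real.toNNReal (σ ^ 2))

/-- The normalized squared loss between the Gram matrices of the estimated and the true
configurations. -/
noncomputable def lossFn (n T d : ℕ) (Xhat X : Config n T d) : ℝ :=
  (1 / ((T : ℝ) * n * ((n : ℝ) - 1))) * ∑ t : Fin T, ∑ i : Fin n, ∑ j : Fin n,
    if i ≠ j then (⟪Xhat i t, Xhat j t⟫ - ⟪X i t, X j t⟫) ^ 2 else 0


namespace MeasureTheory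

/-- Tonelli's theorem for a product of functions of the individual coordinates. -/
lemma lintegral_pi_prod_eq_prod_lintegral {ι : Type*} [Fintype ι] (μ : ι → Measure ℝ)
    [∀ i, IsProbabilityMeasure (μ i)] {f : ι → ℝ → ℝ≥0∞} (hf : ∀ i, Measurable (f i)) :
    ∫⁻ x, ∏ i, f i (x i) ∂(Measure.pi μ) = ∏ i, ∫⁻ x, f i x ∂(μ i) := by
  refine (lintegral_prod_eq_prod_lintegral_of_indepFun Finset.univ
    (fun i (x : ι → ℝ) => f i (x i)) (iIndepFun_pi fun i => (hf i).aemeasurable)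
    fun i => (hf i).comp (measurable_pi_apply i)).trans ?_
  exact Finset.prod_congr rfl fun i _ => (measurePreserving_eval μ i).lintegral_comp (hf i)

lemma Measure.pi_withDensity_eq {ι : Type*} [Fintype ι] (μ : ι → Measure ℝ)
    [∀ i, IsProbabilityMeasure (μ i)] {f : ι → ℝ → ℝ≥0∞} (hf : ∀ i, Measurable (f i))
    [∀ i, SigmaFinite ((μ i).withDensity (f i))] :
    Measure.pi (fun i => (μ i).withDensity (f i)) =
      (Measure.pi μ).withDensity fun x => ∏ i, f i (x i) := by
  refine Measure.pi_eq fun s hs => ?_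
  rw [withDensity_apply _ (MeasurableSet.univ_pi hs),
    ← lintegral_indicator (MeasurableSet.univ_pi hs)]
  have h : (Set.univ.pi s).indicator (fun x : ι → ℝ => ∏ i, f i (x i)) =
      fun x => ∏ i, (s i).indicator (f i) (x i) := by
    ext x
    by_cases hx : x ∈ Set.univ.pi s
    · rw [Set.indicator_of_mem hx]
      exact Finset.prod_congr rfl fun i _ =>
        (Set.indicator_of_mem (hx i (Set.mem_univ i)) (f i)).symm
    · rw [Set.indicator_of_notMem hx]
      simp only [Set.mem_pi, Set.mem_univ, true_imp_iff, not_forall] at hx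
      obtain ⟨i, hi⟩ := hx
      exact (Finset.prod_eq_zero (Finset.mem_univ i) (Set.indicator_of_notMem hi (f i))).symm
  rw [h, lintegral_pi_prod_eq_prod_lintegral μ fun i => (hf i).indicator (hs i)]
  refine Finset.prod_congr rfl fun i _ => ?_
  rw [withDensity_apply _ (hs i), lintegral_indicator (hs i)]

end MeasureTheory

namespace ProbabilityTheory

/-- The likelihood ratio of `N(b, v)` with respect to `N(a, v)`. -/
noncomputable def gaussianRatio (a b : ℝ) (v : NNReal) (x : ℝ) : ℝ≥0∞ :=
  ENNReal.ofReal (Real.exp ((b - a) * (x - a) / v - (b - a) ^ 2 / (2 * v)))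

lemma measurable_gaussianRatio (a b : ℝ) (v : NNReal) : Measurable (gaussianRatio a b v) := by
  unfold gaussianRatio
  fun_prop

lemma gaussianReal_withDensity_gaussianRatio (a b : ℝ) {v : NNReal} (hv : v ≠ 0) :
    (gaussianReal a v).withDensity (gaussianRatio a b v) = gaussianReal b v := by
  rw [gaussianReal_of_var_ne_zero _ hv, gaussianReal_of_var_ne_zero _ hv,
    ← withDensity_mul _ (measurable_gaussianPDF a v) (measurable_gaussianRatio a b v)]
  congr 1
  ext x
  have hv' : (v : ℝ) ≠ 0 := by exact_mod_cast hv
  rw [Pi.mul_apply, gaussianPDF, gaussianPDF, gaussianRatio,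
    ← ENNReal.ofReal_mul (gaussianPDFReal_nonneg _ _ _), gaussianPDFReal, gaussianPDFReal,
    mul_assoc, ← Real.exp_add]
  congr 3
  field_simp
  ring

lemma lintegral_gaussianRatio_sq (a b : ℝ) {v : NNReal} (hv : v ≠ 0) :
    ∫⁻ x, gaussianRatio a b v x ^ 2 ∂(gaussianReal a v) =
      ENNReal.ofReal (Real.exp ((b - a) ^ 2 / v)) := by
  have hv' : (v : ℝ) ≠ 0 := by exact_mod_cast hv
  rw [gaussianReal_of_var_ne_zero _ hv, lintegral_withDensity_eq_lintegral_mul _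
    (measurable_gaussianPDF a v) ((measurable_gaussianRatio a b v).pow_const 2)]
  have h : ∀ x, (gaussianPDF a v * fun x => gaussianRatio a b v x ^ 2) x =
      ENNReal.ofReal (Real.exp ((b - a) ^ 2 / v)) * gaussianPDF (2 * b - a) v x := by
    intro x
    rw [Pi.mul_apply, gaussianPDF, gaussianPDF, gaussianRatio,
      ← ENNReal.ofReal_pow (Real.exp_nonneg _), ← Real.exp_nat_mul,
      ← ENNReal.ofReal_mul (gaussianPDFReal_nonneg _ _ _),
      ← ENNReal.ofReal_mul (Real.exp_nonneg _), gaussianPDFReal, gaussianPDFReal,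
      mul_assoc, mul_left_comm (Real.exp _), ← Real.exp_add, ← Real.exp_add]
    congr 3
    push_cast
    field_simp
    ring
  simp_rw [h]
  rw [lintegral_const_mul _ (measurable_gaussianPDF _ _), lintegral_gaussianPDF_eq_one _ hv,
    mul_one]

/-- A two-point bound for product Gaussian measures whose squared mean distance is at most the
variance. -/
lemma two_point_gaussian_lower_bound {ι : Type*} [Fintype ι] (a b : ι → ℝ) {v : NNReal}
    (hv : v ≠ 0) (hab : ∑ i, (b i - a i) ^ 2 ≤ v) {f g : (ι → ℝ) → ℝ≥0∞} (hf : Measurable f)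
    (hg : Measurable g) {s : ℝ≥0∞} (hs : s ≠ ∞)
    (hfg : ∀ y, s ≤ f y + g y) :
    s ≤ 4 * (∫⁻ y, f y ∂(Measure.pi fun i => gaussianReal (a i) v) +
      ∫⁻ y, g y ∂(Measure.pi fun i => gaussianReal (b i) v)) := by
  set P := Measure.pi fun i => gaussianReal (a i) v with hP
  set l : (ι → ℝ) → ℝ≥0∞ := fun x => ∏ i, gaussianRatio (a i) (b i) v (x i) with hl
  have hlm : Measurable l := Finset.measurable_fun_prod _ fun i _ =>
    (measurable_gaussianRatio _ _ _).comp (measurable_pi_apply i)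
  have hQ : (Measure.pi fun i => gaussianReal (b i) v) = P.withDensity l := by
    have : ∀ i, SigmaFinite
        ((gaussianReal (a i) v).withDensity (gaussianRatio (a i) (b i) v)) := fun i => by
      rw [gaussianReal_withDensity_gaussianRatio _ _ hv]; infer_instance
    rw [hP, hl, ← Measure.pi_withDensity_eq _ fun i => measurable_gaussianRatio _ _ _]
    simp_rw [gaussianReal_withDensity_gaussianRatio _ _ hv]
  have hone : ∫⁻ y, l y ∂P = 1 := by
    rw [← setLIntegral_univ, ← withDensity_apply _ MeasurableSet.univ, ← hQ, measure_univ]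
  have hsq : ∫⁻ y, l y ^ 2 ∂P ≤ 3 := by
    have hv' : (0 : ℝ) < v := by exact_mod_cast pos_iff_ne_zero.mpr hv
    simp_rw [hl, ← Finset.prod_pow]
    rw [lintegral_pi_prod_eq_prod_lintegral _
      fun i => (measurable_gaussianRatio (a i) (b i) v).pow_const 2]
    simp_rw [lintegral_gaussianRatio_sq _ _ hv]
    rw [← ENNReal.ofReal_prod_of_nonneg fun i _ => Real.exp_nonneg _, ← Real.exp_sum,
      ← Finset.sum_div]
    have h1 : (∑ i, (b i - a i) ^ 2) / (v : ℝ) ≤ 1 := (div_le_one hv').mpr hab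
    have h3 : Real.exp ((∑ i, (b i - a i) ^ 2) / (v : ℝ)) ≤ 3 :=
      (Real.exp_le_exp.mpr h1).trans Real.exp_one_lt_three.le
    exact (ENNReal.ofReal_le_ofReal h3).trans (by simp)
  have hpt : ∀ y, 4 * (s * l y) ≤ 4 * (f y + l y * g y) + s * l y ^ 2 := by
    intro y
    have hltop : l y ≠ ∞ := ENNReal.prod_ne_top fun i _ => ENNReal.ofReal_ne_top
    have hmin : 4 * l y ≤ 4 * min 1 (l y) + l y ^ 2 := by
      lift l y to NNReal using hltop with r
      have : 4 * r ≤ 4 * min 1 r + r ^ 2 := by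
        rcases le_total 1 r with h | h
        · rw [min_eq_left h, ← NNReal.coe_le_coe]
          push_cast
          nlinarith [sq_nonneg ((r : ℝ) - 2)]
        · rw [min_eq_right h]; exact le_self_add
      exact_mod_cast this
    have hsm : s * min 1 (l y) ≤ f y + l y * g y := by
      calc s * min 1 (l y) ≤ (f y + g y) * min 1 (l y) := by gcongr; exact hfg y
        _ = f y * min 1 (l y) + min 1 (l y) * g y := by ring
        _ ≤ f y * 1 + l y * g y := by gcongr <;> simp
        _ = _ := by rw [mul_one]
    calc 4 * (s * l y) = s * (4 * l y) := by ring
      _ ≤ s * (4 * min 1 (l y) + l y ^ 2) := by gcongr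
      _ = 4 * (s * min 1 (l y)) + s * l y ^ 2 := by ring
      _ ≤ _ := by gcongr
  rw [hQ, lintegral_withDensity_eq_lintegral_mul _ hlm hg, ← lintegral_add_left hf]
  simp only [Pi.mul_apply]
  have hint := lintegral_mono (μ := P) hpt
  rw [lintegral_const_mul _ (hlm.const_mul s), lintegral_const_mul _ hlm, hone,
    lintegral_add_right _ ((hlm.pow_const 2).const_mul s),
    lintegral_const_mul _ (hf.fun_add (hlm.fun_mul hg)),
    lintegral_const_mul _ (hlm.pow_const 2)] at hint
  have h2 : s + 3 * s ≤ 4 * ∫⁻ y, f y + l y * g y ∂P + 3 * s := by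
    calc s + 3 * s = 4 * (s * 1) := by ring
      _ ≤ _ := hint
      _ ≤ 4 * ∫⁻ y, f y + l y * g y ∂P + s * 3 := by gcongr
      _ = _ := by ring
  exact (ENNReal.add_le_add_iff_right (ENNReal.mul_ne_top (by simp) hs)).mp h2

end ProbabilityTheory

/-- Assouad's lemma: a risk that dominates a sum of coordinate risks, each of which is bounded below
on every pair of neighbouring hypotheses, is large for some hypothesis. -/
lemma assouad_lower_bound {Ω P : Type*} [Fintype Ω] [Nonempty Ω] (I : Finset P)
    (flip : P → Equiv.Perm Ω) (G : P → Ω → ℝ≥0∞) (s S : ℝ≥0∞)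
    (hflip : ∀ p ∈ I, ∀ ω, s ≤ 4 * (G p ω + G p (flip p ω)))
    (hS : ∀ ω, ∑ p ∈ I, G p ω ≤ S) : I.card * s ≤ 8 * S := by
  have hp : ∀ p ∈ I, Fintype.card Ω * s ≤ 8 * ∑ ω, G p ω := fun p hpI => by
    calc Fintype.card Ω * s = ∑ _ω : Ω, s := by simp
      _ ≤ ∑ ω, 4 * (G p ω + G p (flip p ω)) := Finset.sum_le_sum fun ω _ => hflip p hpI ω
      _ = 8 * ∑ ω, G p ω := by
        rw [← Finset.mul_sum, Finset.sum_add_distrib, Equiv.sum_comp (flip p) (G p)]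
        ring
  have h : (Fintype.card Ω : ℝ≥0∞) * (I.card * s) ≤ Fintype.card Ω * (8 * S) := by
    calc (Fintype.card Ω : ℝ≥0∞) * (I.card * s) = ∑ _p ∈ I, Fintype.card Ω * s := by
          simp only [Finset.sum_const, nsmul_eq_mul]
          ring
      _ ≤ ∑ p ∈ I, 8 * ∑ ω, G p ω := Finset.sum_le_sum hp
      _ = 8 * ∑ ω, ∑ p ∈ I, G p ω := by rw [← Finset.mul_sum, Finset.sum_comm]
      _ ≤ 8 * ∑ _ω : Ω, S := by gcongr with ω; exact hS ω
      _ = Fintype.card Ω * (8 * S) := by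
        simp only [Finset.sum_const, nsmul_eq_mul, Finset.card_univ]
        ring
  exact (ENNReal.mul_le_mul_iff_right (by simp) (ENNReal.natCast_ne_top _)).mp h

/-- Negation of one bit of a Boolean vector. -/
def flipBit {P : Type*} [DecidableEq P] (p : P) : Equiv.Perm (P → Bool) :=
  Function.Involutive.toPerm (fun ω => Function.update ω p (!ω p)) fun ω => by simp

lemma flipBit_self {P : Type*} [DecidableEq P] (p : P) (ω : P → Bool) :
    flipBit p ω p = !ω p :=
  Function.update_self _ _ _

lemma flipBit_of_ne {P : Type*} [DecidableEq P] {p q : P} (h : q ≠ p) (ω : P → Bool) :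
    flipBit p ω q = ω q :=
  Function.update_of_ne h _ _

/-- One-dimensional positions: the first `a` nodes sit at `r`, every other one at `±δ`. -/
def hypercubeCoord {n : ℕ} {K : Type*} (a : ℕ) (r δ : ℝ) (ω : Fin n × K → Bool) (i : Fin n)
    (k : K) : ℝ :=
  if i.1 < a then r else if ω (i, k) then δ else -δ

/-- The configuration on a line with positions `hypercubeCoord`, where `κ t` is the block of the
time point `t`. -/
noncomputable def hypercubeConfig {n T d : ℕ} {K : Type*} (e : EuclideanSpace ℝ (Fin d)) (a : ℕ)
    (r δ : ℝ) (κ : Fin T → K) (ω : Fin n × K → Bool) : Config n T d :=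
  fun i t => hypercubeCoord a r δ ω i (κ t) • e

lemma inner_hypercubeConfig {n T d : ℕ} {K : Type*} {e : EuclideanSpace ℝ (Fin d)} (he : ‖e‖ = 1)
    (a : ℕ) (r δ : ℝ) (κ : Fin T → K) (ω : Fin n × K → Bool) (i j : Fin n) (t : Fin T) :
    ⟪hypercubeConfig e a r δ κ ω i t, hypercubeConfig e a r δ κ ω j t⟫ =
      hypercubeCoord a r δ ω i (κ t) * hypercubeCoord a r δ ω j (κ t) := by
  rw [hypercubeConfig, hypercubeConfig, real_inner_smul_left, real_inner_smul_right,
    real_inner_self_eq_norm_sq, he]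
  ring

lemma abs_hypercubeCoord_le {n : ℕ} {K : Type*} {a : ℕ} {r δ : ℝ} (hδ : 0 ≤ δ) (hδr : δ ≤ r)
    (ω : Fin n × K → Bool) (i : Fin n) (k : K) : |hypercubeCoord a r δ ω i k| ≤ r := by
  unfold hypercubeCoord
  split_ifs
  · rw [abs_of_nonneg (hδ.trans hδr)]
  · rwa [abs_of_nonneg hδ]
  · rwa [abs_neg, abs_of_nonneg hδ]

lemma hypercubeCoord_flipBit_of_ne {n : ℕ} {K : Type*} [DecidableEq K] (a : ℕ) (r δ : ℝ)
    (ω : Fin n × K → Bool) {p : Fin n × K} {i : Fin n} {k : K} (h : (i, k) ≠ p) :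
    hypercubeCoord a r δ (flipBit p ω) i k = hypercubeCoord a r δ ω i k := by
  rw [hypercubeCoord, hypercubeCoord, flipBit_of_ne h]

lemma hypercubeCoord_flipBit_self {n : ℕ} {K : Type*} [DecidableEq K] {a : ℕ} (r δ : ℝ)
    (ω : Fin n × K → Bool) {i : Fin n} (hi : a ≤ i.1) (k : K) :
    hypercubeCoord a r δ (flipBit (i, k) ω) i k = -hypercubeCoord a r δ ω i k := by
  rw [hypercubeCoord, hypercubeCoord, flipBit_self, if_neg hi.not_gt, if_neg hi.not_gt]
  cases ω (i, k) <;> simp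

lemma hypercubeCoord_sq {n : ℕ} {K : Type*} {a : ℕ} (r δ : ℝ)
    (ω : Fin n × K → Bool) {i : Fin n} (hi : a ≤ i.1) (k : K) :
    hypercubeCoord a r δ ω i k ^ 2 = δ ^ 2 := by
  rw [hypercubeCoord, if_neg hi.not_gt]
  split_ifs <;> ring

/-- Flipping one bit changes only the Gram entries of one node in one time block, each by at most
`2 * (r * δ)`. -/
lemma sq_hypercubeCoord_mul_sub_le {n : ℕ} {K : Type*} [DecidableEq K] {a : ℕ} {r δ : ℝ}
    (hδ : 0 ≤ δ) (hδr : δ ≤ r) (ω : Fin n × K → Bool) {i₀ : Fin n} (hi₀ : a ≤ i₀.1) (k₀ : K)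
    {i j : Fin n} (hij : i ≠ j) (k : K) :
    (hypercubeCoord a r δ (flipBit (i₀, k₀) ω) i k * hypercubeCoord a r δ (flipBit (i₀, k₀) ω) j k -
        hypercubeCoord a r δ ω i k * hypercubeCoord a r δ ω j k) ^ 2 ≤
      if k = k₀ then (if i = i₀ then 4 * (r * δ) ^ 2 else 0) +
        (if j = i₀ then 4 * (r * δ) ^ 2 else 0) else 0 := by
  have key : ∀ j : Fin n, (2 * hypercubeCoord a r δ ω i₀ k₀ * hypercubeCoord a r δ ω j k₀) ^ 2 ≤
      4 * (r * δ) ^ 2 := fun j => by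
    have h := sq_le_sq' (abs_le.mp (abs_hypercubeCoord_le (a := a) hδ hδr ω j k₀)).1
      (abs_le.mp (abs_hypercubeCoord_le (a := a) hδ hδr ω j k₀)).2
    rw [mul_pow, mul_pow, hypercubeCoord_sq r δ ω hi₀]
    nlinarith [sq_nonneg δ]
  by_cases hk : k = k₀
  · subst hk
    rw [if_pos rfl]
    by_cases hi : i = i₀
    · subst hi
      rw [if_pos rfl, if_neg hij.symm, add_zero, hypercubeCoord_flipBit_self r δ ω hi₀,
        hypercubeCoord_flipBit_of_ne a r δ ω (p := (i, k)) (by simp [hij.symm])]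
      refine le_trans (le_of_eq ?_) (key j)
      ring
    · rw [if_neg hi, zero_add, hypercubeCoord_flipBit_of_ne a r δ ω (p := (i₀, k)) (by simp [hi])]
      by_cases hj : j = i₀
      · subst hj
        rw [if_pos rfl, hypercubeCoord_flipBit_self r δ ω hi₀]
        refine le_trans (le_of_eq ?_) (key i)
        ring
      · rw [if_neg hj, hypercubeCoord_flipBit_of_ne a r δ ω (p := (i₀, k)) (by simp [hj])]
        simp
  · rw [if_neg hk, hypercubeCoord_flipBit_of_ne a r δ ω (by simp [hk]),
      hypercubeCoord_flipBit_of_ne a r δ ω (by simp [hk])]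
    simp

lemma sum_sq_inner_hypercubeConfig_sub_le {n T d : ℕ} {K : Type*} [DecidableEq K]
    {e : EuclideanSpace ℝ (Fin d)} (he : ‖e‖ = 1) {a : ℕ} {r δ : ℝ} (hδ : 0 ≤ δ) (hδr : δ ≤ r)
    (κ : Fin T → K) {m : ℕ} (hm : ∀ k, (Finset.univ.filter fun t => κ t = k).card = m)
    (ω : Fin n × K → Bool) {i₀ : Fin n} (hi₀ : a ≤ i₀.1) (k₀ : K) :
    ∑ q : ObsIdx n T,
      (⟪hypercubeConfig e a r δ κ (flipBit (i₀, k₀) ω) q.1.1 q.1.2.2,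
          hypercubeConfig e a r δ κ (flipBit (i₀, k₀) ω) q.1.2.1 q.1.2.2⟫ -
        ⟪hypercubeConfig e a r δ κ ω q.1.1 q.1.2.2,
          hypercubeConfig e a r δ κ ω q.1.2.1 q.1.2.2⟫) ^ 2 ≤ 8 * n * m * (r * δ) ^ 2 := by
  let h : Fin n × Fin n × Fin T → ℝ := fun p =>
    if κ p.2.2 = k₀ then (if p.1 = i₀ then 4 * (r * δ) ^ 2 else 0) +
        (if p.2.1 = i₀ then 4 * (r * δ) ^ 2 else 0) else 0
  have hh : ∀ p, 0 ≤ h p := fun p => by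
    simp only [h]
    split_ifs <;> positivity
  calc _ ≤ ∑ q : ObsIdx n T, h q.1 := by
        refine Finset.sum_le_sum fun q _ => ?_
        rw [inner_hypercubeConfig he, inner_hypercubeConfig he]
        exact sq_hypercubeCoord_mul_sub_le hδ hδr ω hi₀ k₀ q.2 _
    _ = ∑ p ∈ Finset.univ.filter (fun p : Fin n × Fin n × Fin T => p.1 ≠ p.2.1), h p :=
        (Finset.sum_subtype _ (by simp) h).symm
    _ ≤ ∑ p, h p := Finset.sum_le_sum_of_subset_of_nonneg (Finset.filter_subset _ _)
        fun p _ _ => hh p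
    _ = 8 * n * m * (r * δ) ^ 2 := by
        have ht : ∀ i j, ∑ t, h (i, j, t) = m * ((if i = i₀ then 4 * (r * δ) ^ 2 else 0) +
            (if j = i₀ then 4 * (r * δ) ^ 2 else 0)) := fun i j => by
          change ∑ t, (if κ t = k₀ then (if i = i₀ then 4 * (r * δ) ^ 2 else 0) +
            (if j = i₀ then 4 * (r * δ) ^ 2 else 0) else 0) = _
          rw [← Finset.sum_filter, Finset.sum_const, hm, nsmul_eq_mul]
        simp_rw [Fintype.sum_prod_type, ht, ← Finset.mul_sum, Finset.sum_add_distrib]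
        simp
        ring

/-- Squared error of the estimated Gram entries between node `p.1` and the first `a` nodes over the
time block `p.2`, against the truth `r * x`. -/
noncomputable def blockError {n T d : ℕ} {K : Type*} [DecidableEq K] (a : ℕ) (r : ℝ) (κ : Fin T → K)
    (p : Fin n × K) (x : ℝ) (Z : Config n T d) : ℝ :=
  ∑ t : Fin T, ∑ j : Fin n,
    if κ t = p.2 then (if j.1 < a then (⟪Z p.1 t, Z j t⟫ - r * x) ^ 2 else 0) else 0

lemma measurable_blockError {n T d : ℕ} {K : Type*} [DecidableEq K] (a : ℕ) (r : ℝ) (κ : Fin T → K)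
    (p : Fin n × K) (x : ℝ) :
    Measurable (blockError a r κ p x : Config n T d → ℝ) := by
  have h : ∀ (i : Fin n) (t : Fin T), Measurable fun Z : Config n T d => Z i t := fun i t =>
    (measurable_pi_apply t).comp (measurable_pi_apply i)
  unfold blockError
  refine Finset.measurable_fun_sum _ fun t _ => Finset.measurable_fun_sum _ fun j _ => ?_
  split_ifs
  · exact (((h _ t).inner (h j t)).sub_const _).pow_const 2
  · exact measurable_const
  · exact measurable_const

lemma blockError_nonneg {n T d : ℕ} {K : Type*} [DecidableEq K] (a : ℕ) (r : ℝ) (κ : Fin T → K)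
    (p : Fin n × K) (x : ℝ) (Z : Config n T d) : 0 ≤ blockError a r κ p x Z :=
  Finset.sum_nonneg fun t _ => Finset.sum_nonneg fun j _ => by split_ifs <;> positivity

lemma le_blockError_add_neg {n T d : ℕ} {K : Type*} [DecidableEq K] {a : ℕ} (ha : a ≤ n) (r : ℝ)
    (κ : Fin T → K) {m : ℕ} (hm : ∀ k, (Finset.univ.filter fun t => κ t = k).card = m)
    (p : Fin n × K) (x : ℝ) (Z : Config n T d) :
    2 * m * a * (r * x) ^ 2 ≤ blockError a r κ p x Z + blockError a r κ p (-x) Z := by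
  have hcard : (Finset.univ.filter fun j : Fin n => j.1 < a).card = a := by
    rw [Fin.card_filter_val_lt, min_eq_right ha]
  calc 2 * m * a * (r * x) ^ 2 = ∑ t : Fin T, ∑ j : Fin n,
        if κ t = p.2 then (if j.1 < a then 2 * (r * x) ^ 2 else 0) else 0 := by
        have ht : ∀ t : Fin T, (∑ j : Fin n,
            if κ t = p.2 then (if j.1 < a then 2 * (r * x) ^ 2 else 0) else 0) =
            if κ t = p.2 then a * (2 * (r * x) ^ 2) else 0 := fun t => by
          split_ifs
          · rw [← Finset.sum_filter, Finset.sum_const, hcard, nsmul_eq_mul]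
          · simp
        rw [Finset.sum_congr rfl fun t _ => ht t, ← Finset.sum_filter, Finset.sum_const, hm,
          nsmul_eq_mul]
        ring
    _ ≤ _ := by
        rw [blockError, blockError, ← Finset.sum_add_distrib]
        refine Finset.sum_le_sum fun t _ => ?_
        rw [← Finset.sum_add_distrib]
        refine Finset.sum_le_sum fun j _ => ?_
        split_ifs
        · nlinarith [sq_nonneg ⟪Z p.1 t, Z j t⟫]
        · simp
        · simp

/-- The loss dominates the sum of the block errors of the nodes from `a` on. -/
lemma sum_blockError_le_lossFn {n T d : ℕ} (hn : 1 ≤ n) {K : Type*} [Fintype K] [DecidableEq K]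
    {e : EuclideanSpace ℝ (Fin d)} (he : ‖e‖ = 1) (a : ℕ) (r δ : ℝ) (κ : Fin T → K)
    (ω : Fin n × K → Bool) (Z : Config n T d) :
    ∑ p ∈ (Finset.univ.filter fun i : Fin n => a ≤ i.1) ×ˢ (Finset.univ : Finset K),
      1 / ((T : ℝ) * n * ((n : ℝ) - 1)) *
        blockError a r κ p (hypercubeCoord a r δ ω p.1 p.2) Z ≤
      lossFn n T d Z (hypercubeConfig e a r δ κ ω) := by
  have hn' : (0 : ℝ) ≤ (n : ℝ) - 1 := by
    rw [sub_nonneg]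
    exact_mod_cast hn
  rw [← Finset.mul_sum, lossFn]
  refine mul_le_mul_of_nonneg_left ?_ (by positivity)
  rw [Finset.sum_product]
  have hk : ∀ i : Fin n, ∑ k, blockError a r κ (i, k) (hypercubeCoord a r δ ω i k) Z =
      ∑ t, ∑ j : Fin n, if j.1 < a then
        (⟪Z i t, Z j t⟫ - r * hypercubeCoord a r δ ω i (κ t)) ^ 2 else 0 := fun i => by
    simp only [blockError]
    rw [Finset.sum_comm]
    refine Finset.sum_congr rfl fun t _ => ?_
    rw [Finset.sum_comm]
    refine Finset.sum_congr rfl fun j _ => ?_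
    rw [Finset.sum_ite_eq Finset.univ (κ t), if_pos (Finset.mem_univ _)]
  simp only [hk]
  rw [Finset.sum_comm]
  refine Finset.sum_le_sum fun t _ => ?_
  rw [Finset.sum_filter]
  refine Finset.sum_le_sum fun i _ => ?_
  split_ifs with hi
  · refine Finset.sum_le_sum fun j _ => ?_
    by_cases hj : j.1 < a
    · have hij : i ≠ j := by
        rintro rfl
        omega
      rw [if_pos hj, if_pos hij, inner_hypercubeConfig he]
      refine le_of_eq ?_
      rw [show hypercubeCoord a r δ ω j (κ t) = r from if_pos hj, mul_comm r]
    · rw [if_neg hj]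
      split_ifs <;> positivity
  · exact Finset.sum_nonneg fun j _ => by split_ifs <;> positivity

/-- The minimax bound obtained from the hypercube of configurations with time blocks of length
`m`. -/
lemma hypercube_risk_lower_bound {n T d : ℕ} (hn : 1 ≤ n) {K : Type*} [Fintype K]
    [DecidableEq K] {e : EuclideanSpace ℝ (Fin d)} (he : ‖e‖ = 1) {a : ℕ} (ha : a ≤ n) {r δ : ℝ}
    (hδ : 0 ≤ δ) (hδr : δ ≤ r) {σ : ℝ} (hσ : 0 < σ) (κ : Fin T → K) {m : ℕ}
    (hm : ∀ k, (Finset.univ.filter fun t => κ t = k).card = m)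
    (hsep : 8 * n * m * (r * δ) ^ 2 ≤ σ ^ 2) {Xhat : (ObsIdx n T → ℝ) → Config n T d}
    (hX : Measurable Xhat) {S : ℝ≥0∞}
    (hS : ∀ ω : Fin n × K → Bool,
      ∫⁻ y, ENNReal.ofReal (lossFn n T d (Xhat y) (hypercubeConfig e a r δ κ ω))
        ∂(gaussianModel n T d σ (hypercubeConfig e a r δ κ ω)) ≤ S) :
    ENNReal.ofReal ((n - a : ℕ) * Fintype.card K * (1 / ((T : ℝ) * n * ((n : ℝ) - 1))) *
      (m * a * (r * δ) ^ 2) / 4) ≤ S := by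
  have hn' : (0 : ℝ) ≤ (n : ℝ) - 1 := by
    rw [sub_nonneg]
    exact_mod_cast hn
  set C : ℝ := 1 / ((T : ℝ) * n * ((n : ℝ) - 1)) with hC
  have hC0 : 0 ≤ C := by positivity
  set I := (Finset.univ.filter fun i : Fin n => a ≤ i.1) ×ˢ (Finset.univ : Finset K) with hI
  let G : Fin n × K → (Fin n × K → Bool) → ℝ≥0∞ := fun p ω =>
    ∫⁻ y, ENNReal.ofReal (C * blockError a r κ p (hypercubeCoord a r δ ω p.1 p.2) (Xhat y))
      ∂(gaussianModel n T d σ (hypercubeConfig e a r δ κ ω))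
  have hmeas : ∀ (p : Fin n × K) (x : ℝ),
      Measurable fun y => ENNReal.ofReal (C * blockError a r κ p x (Xhat y)) := fun p x =>
    (((measurable_blockError a r κ p x).comp hX).const_mul C).ennreal_ofReal
  have hv : Real.toNNReal (σ ^ 2) ≠ 0 := by
    rw [ne_eq, Real.toNNReal_eq_zero, not_le]
    positivity
  have hflip : ∀ p ∈ I, ∀ ω,
      ENNReal.ofReal (C * (2 * m * a * (r * δ) ^ 2)) ≤ 4 * (G p ω + G p (flipBit p ω)) := by
    rintro ⟨i, k⟩ hp ω
    have hi : a ≤ i.1 := by simpa [hI] using hp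
    refine two_point_gaussian_lower_bound _ _ hv ?_ (hmeas _ _) (hmeas _ _)
      ENNReal.ofReal_ne_top fun y => ?_
    · rw [Real.coe_toNNReal _ (sq_nonneg σ)]
      exact (sum_sq_inner_hypercubeConfig_sub_le he hδ hδr κ hm ω hi k).trans hsep
    · rw [← ENNReal.ofReal_add (mul_nonneg hC0 (blockError_nonneg _ _ _ _ _ _))
        (mul_nonneg hC0 (blockError_nonneg _ _ _ _ _ _)), ← mul_add,
        hypercubeCoord_flipBit_self r δ ω hi]
      have h := le_blockError_add_neg ha r κ hm (i, k) (hypercubeCoord a r δ ω i k) (Xhat y)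
      rw [mul_pow, hypercubeCoord_sq r δ ω hi, ← mul_pow] at h
      exact ENNReal.ofReal_le_ofReal (mul_le_mul_of_nonneg_left h hC0)
  have hsum : ∀ ω, ∑ p ∈ I, G p ω ≤ S := fun ω => by
    refine le_trans ?_ (hS ω)
    simp only [G]
    rw [← lintegral_finsetSum _ fun p _ => hmeas p _]
    refine lintegral_mono fun y => ?_
    rw [← ENNReal.ofReal_sum_of_nonneg fun p _ => mul_nonneg hC0 (blockError_nonneg _ _ _ _ _ _)]
    exact ENNReal.ofReal_le_ofReal (sum_blockError_le_lossFn hn he a r δ κ ω (Xhat y))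
  have hA := assouad_lower_bound I flipBit G _ S hflip hsum
  have hcard : I.card = (n - a) * Fintype.card K := by
    have h1 := Finset.card_filter_add_card_filter_not (s := (Finset.univ : Finset (Fin n)))
      (fun i => i.1 < a)
    simp only [not_lt, Fin.card_filter_val_lt, min_eq_right ha, Finset.card_univ,
      Fintype.card_fin] at h1
    rw [hI, Finset.card_product, Finset.card_univ]
    congr 1
    omega
  have h8 : (8 : ℝ≥0∞) * ENNReal.ofReal ((n - a : ℕ) * Fintype.card K * C *
      (m * a * (r * δ) ^ 2) / 4) ≤ 8 * S := by
    refine le_trans (le_of_eq ?_) hA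
    rw [hcard, ← ENNReal.ofReal_natCast, ← ENNReal.ofReal_mul (Nat.cast_nonneg _),
      ← ENNReal.ofReal_ofNat 8, ← ENNReal.ofReal_mul (by norm_num)]
    congr 1
    push_cast
    ring
  exact (ENNReal.mul_le_mul_iff_right (by norm_num) (by norm_num)).mp h8

/-- `hypercube_risk_lower_bound` with half of the nodes fixed and the optimal separation. -/
lemma hypercube_risk_lower_bound_half {n T d : ℕ} (hn : 2 ≤ n) (hT : 1 ≤ T) {K : Type*}
    [Fintype K] [DecidableEq K] {e : EuclideanSpace ℝ (Fin d)} (he : ‖e‖ = 1) {r δ : ℝ}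
    (hδ : 0 ≤ δ) (hδr : δ ≤ r) {σ : ℝ} (hσ : 0 < σ) (κ : Fin T → K) {m : ℕ} (hm0 : 1 ≤ m)
    (hm : ∀ k, (Finset.univ.filter fun t => κ t = k).card = m)
    (hsep : (r * δ) ^ 2 = σ ^ 2 / (8 * n * m)) {Xhat : (ObsIdx n T → ℝ) → Config n T d}
    (hX : Measurable Xhat) {L : ℝ}
    (hL : ∀ ω : Fin n × K → Bool, hypercubeConfig e (n / 2) r δ κ ω ∈ PWD n T d L) :
    ENNReal.ofReal (σ ^ 2 / 200 * (Fintype.card K / (n * T))) ≤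
      ⨆ (X : Config n T d) (_ : X ∈ PWD n T d L),
        ∫⁻ y, ENNReal.ofReal (lossFn n T d (Xhat y) X) ∂(gaussianModel n T d σ X) := by
  have hnR : (2 : ℝ) ≤ n := by exact_mod_cast hn
  have hTR : (1 : ℝ) ≤ T := by exact_mod_cast hT
  have hmR : (1 : ℝ) ≤ m := by exact_mod_cast hm0
  refine le_trans (ENNReal.ofReal_le_ofReal ?_) (hypercube_risk_lower_bound (by omega) he
    (Nat.div_le_self n 2) hδ hδr hσ κ hm (by rw [hsep]; field_simp; rfl) hX
    fun ω => le_iSup₂ (f := fun (X : Config n T d) (_ : X ∈ PWD n T d L) =>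
      ∫⁻ y, ENNReal.ofReal (lossFn n T d (Xhat y) X) ∂(gaussianModel n T d σ X)) _ (hL ω))
  have hhalf : (n : ℝ) * (n - 1) ≤ 4 * ((n - n / 2 : ℕ) * (n / 2 : ℕ)) := by
    obtain ⟨p, rfl | rfl⟩ := Nat.even_or_odd' n
    · rw [show 2 * p - 2 * p / 2 = p by omega, show 2 * p / 2 = p by omega]
      push_cast
      nlinarith
    · rw [show 2 * p + 1 - (2 * p + 1) / 2 = p + 1 by omega, show (2 * p + 1) / 2 = p by omega]
      push_cast
      nlinarith
  have hn1 : (0 : ℝ) < n - 1 := by linarith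
  calc σ ^ 2 / 200 * (Fintype.card K / (n * T))
      ≤ σ ^ 2 / 128 * (Fintype.card K / (n * T)) := by gcongr; norm_num
    _ = σ ^ 2 * Fintype.card K / (128 * n ^ 2 * T * (n - 1)) * (n * (n - 1)) := by field_simp
    _ ≤ σ ^ 2 * Fintype.card K / (128 * n ^ 2 * T * (n - 1)) *
        (4 * ((n - n / 2 : ℕ) * (n / 2 : ℕ))) := by gcongr
    _ = _ := by
      rw [hsep]
      field_simp
      ring

lemma exists_pos_mul_eq {w η : ℝ} (hw : 0 < w) (hη : 0 < η) :
    ∃ r δ : ℝ, 0 < δ ∧ δ ≤ r ∧ r * δ = w ∧ δ ≤ η := by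
  have hs := Real.sqrt_pos.mpr hw
  have hδ : 0 < min √w η := lt_min hs hη
  refine ⟨w / min √w η, min √w η, hδ, ?_, div_mul_cancel₀ _ hδ.ne', min_le_right _ _⟩
  rw [le_div_iff₀ hδ]
  calc min √w η * min √w η ≤ √w * √w := by gcongr <;> exact min_le_left _ _
    _ = w := Real.mul_self_sqrt hw.le

lemma norm_hypercubeConfig_sub_le {n T d : ℕ} {K : Type*} {e : EuclideanSpace ℝ (Fin d)}
    (he : ‖e‖ = 1) (a : ℕ) (r : ℝ) {δ : ℝ} (hδ : 0 ≤ δ) (κ : Fin T → K) (ω : Fin n × K → Bool)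
    (i : Fin n) (t t' : Fin T) :
    ‖hypercubeConfig e a r δ κ ω i t - hypercubeConfig e a r δ κ ω i t'‖ ≤ 2 * δ := by
  rw [hypercubeConfig, hypercubeConfig, ← sub_smul, norm_smul, he, mul_one, Real.norm_eq_abs]
  unfold hypercubeCoord
  split_ifs <;> rw [abs_le] <;> constructor <;> linarith

/-- Minimax lower bound for the Gaussian dynamic latent space model over `PWD(L)`. -/
theorem gaussian_minimax_lower_bound (d : ℕ) (hd : 1 ≤ d) (σ : ℝ) (hσ : 0 < σ) :
    ∃ c : ℝ, 0 < c ∧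
      ∀ (n T : ℕ) (L : ℝ), 0 ≤ L → 16 ≤ n - d + 1 → 2 * d ≤ n → 4 ≤ T →
        ENNReal.ofReal
            (c * (min (L ^ ((2 : ℝ) / 3) / ((n : ℝ) ^ ((4 : ℝ) / 3) * (T : ℝ) ^ ((2 : ℝ) / 3)))
                (1 / (n : ℝ)) + 1 / ((n : ℝ) * T))) ≤
          ⨅ (Xhat : (ObsIdx n T → ℝ) → Config n T d) (_ : Measurable Xhat),
            ⨆ (X : Config n T d) (_ : X ∈ PWD n T d L),
              ∫⁻ y, ENNReal.ofReal (lossFn n T d (Xhat y) X) ∂(gaussianModel n T d σ X) := by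
  refine ⟨σ ^ 2 / 400, by positivity, fun n T L hL hn _ hT => ?_⟩
  refine le_iInf₂ fun Xhat hX => ?_
  have hn2 : 2 ≤ n := by omega
  have hnR : (2 : ℝ) ≤ n := by exact_mod_cast hn2
  have hTR : (4 : ℝ) ≤ T := by exact_mod_cast hT
  obtain ⟨e, he⟩ : ∃ e : EuclideanSpace ℝ (Fin d), ‖e‖ = 1 :=
    ⟨EuclideanSpace.single ⟨0, hd⟩ 1, by simp⟩
  rcases hL.eq_or_lt with rfl | hL
  · obtain ⟨r, δ, hδ, hδr, hw, -⟩ := exists_pos_mul_eq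
      (w := √(σ ^ 2 / (8 * n * T))) (η := 1) (by positivity) one_pos
    refine le_trans (ENNReal.ofReal_le_ofReal ?_) (hypercube_risk_lower_bound_half hn2 (by omega) he
      hδ.le hδr hσ (fun _ => ()) (m := T) (by omega) (by simp)
      (by rw [hw, Real.sq_sqrt (by positivity)]) hX (L := 0) fun ω => ?_)
    · rw [Real.zero_rpow (by norm_num), zero_div, min_eq_left (by positivity), zero_add,
        Fintype.card_unit, Nat.cast_one]
      gcongr
      norm_num
    · simp [PWD, hypercubeConfig]
  · obtain ⟨r, δ, hδ, hδr, hw, hη⟩ := exists_pos_mul_eq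
      (w := √(σ ^ 2 / (8 * n * (1 : ℕ)))) (η := L / (2 * n * T)) (by positivity) (by positivity)
    refine le_trans (ENNReal.ofReal_le_ofReal ?_) (hypercube_risk_lower_bound_half hn2 (by omega) he
      hδ.le hδr hσ id (m := 1) le_rfl (by simp [Finset.filter_eq'])
      (by rw [hw, Real.sq_sqrt (by positivity)]) hX (L := L) fun ω => ?_)
    · have h1 : 1 / ((n : ℝ) * T) ≤ 1 / n :=
        one_div_le_one_div_of_le (by positivity) (le_mul_of_one_le_right (by positivity)
          (by linarith))
      have h2 : (Fintype.card (Fin T) : ℝ) / (n * T) = 1 / n := by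
        rw [Fintype.card_fin]
        field_simp
      rw [h2]
      calc _ ≤ σ ^ 2 / 400 * (1 / n + 1 / n) := by
            gcongr
            exact min_le_right _ _
        _ = _ := by ring
    · calc _ ≤ ∑ _t : Fin (T - 1), ∑ _i : Fin n, 2 * δ :=
            Finset.sum_le_sum fun t _ => Finset.sum_le_sum fun i _ =>
              norm_hypercubeConfig_sub_le he _ _ hδ.le _ _ _ _ _
        _ = (T - 1 : ℕ) * (n * (2 * δ)) := by simp
        _ ≤ T * (n * (2 * (L / (2 * n * T)))) := by
            gcongr
            omega
        _ = L := by field_simp
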